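/- Let M ≥ 3 be an integer and let c, f_c, d, R_D be positive reals and θ_D a real with cos θ_D > 0. Set ξ_m = −(d²·f_c/(2R_D²))·(m−1)² for m = 1,…,M, and define X = (2π²/c²)·∑_{m=1}^{M}∑_{n=1}^{M} (2(ξ_m − ξ_n))², Y = (4π²·d·f_c·cos θ_D/c²)·∑_{m=1}^{M}∑_{n=1}^{M} 2(ξ_m − ξ_n)(m−n), Z = (8π²·f_c²·d²·cos²θ_D/c²)·∑_{m=1}^{M}∑_{n=1}^{M} (m−n)². Then XZ − Y² > 0 and the angular-dimension beamwidth satisfies 2√(M²X/(XZ − Y²)) = c·√(3(16M² − 30M + 11)) / (π·f_c·d·cos θ_D·√((M²−1)(M²−4))). In particular this beamwidth does not depend on R_D. -/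

import Mathlib

open Real Finset

/-- The effective offset sequence of a phased array (zero frequency offsets):
`ξ_m = −(d²·f_c/(2R²))·(m−1)²`, as a function of the target distance `R`. -/
noncomputable def xiPA (d f_c R : ℝ) (m : ℕ) : ℝ :=
  -(d ^ 2 * f_c / (2 * R ^ 2)) * ((m : ℝ) - 1) ^ 2

/-- Coefficient `X` of the half-power boundary quadratic form of Lemma 1. -/
noncomputable def coefX (c : ℝ) (M : ℕ) (ξ : ℕ → ℝ) : ℝ :=
  (2 * π ^ 2 / c ^ 2) * ∑ m ∈ Icc 1 M, ∑ n ∈ Icc 1 M, (2 * (ξ m - ξ n)) ^ 2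

/-- Coefficient `Y` of the half-power boundary quadratic form of Lemma 1. -/
noncomputable def coefY (c d f_c θ_D : ℝ) (M : ℕ) (ξ : ℕ → ℝ) : ℝ :=
  (4 * π ^ 2 * d * f_c * Real.cos θ_D / c ^ 2) *
    ∑ m ∈ Icc 1 M, ∑ n ∈ Icc 1 M, 2 * (ξ m - ξ n) * ((m : ℝ) - (n : ℝ))

/-- Coefficient `Z` of the half-power boundary quadratic form of Lemma 1. -/
noncomputable def coefZ (c d f_c θ_D : ℝ) (M : ℕ) : ℝ :=
  (8 * π ^ 2 * f_c ^ 2 * d ^ 2 * Real.cos θ_D ^ 2 / c ^ 2) *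
    ∑ m ∈ Icc 1 M, ∑ n ∈ Icc 1 M, ((m : ℝ) - (n : ℝ)) ^ 2

/-- The angular-dimension main-lobe beamwidth `Δ_θ = 2√(M²X/(XZ − Y²))` of Theorem 1
for a phased array aimed at distance `R`. -/
noncomputable def angleBeamwidth (c d f_c θ_D : ℝ) (M : ℕ) (R : ℝ) : ℝ :=
  2 * Real.sqrt ((M : ℝ) ^ 2 * coefX c M (xiPA d f_c R) /
    (coefX c M (xiPA d f_c R) * coefZ c d f_c θ_D M -
      coefY c d f_c θ_D M (xiPA d f_c R) ^ 2))

/-- A double sum of products of differences, in terms of single sums. -/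
lemma sum_sum_sub_mul_sub {ι : Type*} (s : Finset ι) (a b : ι → ℝ) :
    ∑ m ∈ s, ∑ n ∈ s, (a m - a n) * (b m - b n) =
      2 * (s.card * ∑ m ∈ s, a m * b m - (∑ m ∈ s, a m) * ∑ m ∈ s, b m) := by
  have h : ∀ m n, (a m - a n) * (b m - b n) =
      a m * b m - a m * b n - a n * b m + a n * b n := fun m n => by ring
  simp only [h, sum_add_distrib, sum_sub_distrib, sum_const, nsmul_eq_mul, ← mul_sum, ← sum_mul]
  ring

lemma sum_Icc_sub_one (M : ℕ) :
    ∑ m ∈ Icc 1 M, ((m : ℝ) - 1) = (M : ℝ) * (M - 1) / 2 := by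
  induction M with
  | zero => simp
  | succ k ih => rw [sum_Icc_succ_top (by omega), ih]; push_cast; ring

lemma sum_Icc_sub_one_pow_two (M : ℕ) :
    ∑ m ∈ Icc 1 M, ((m : ℝ) - 1) ^ 2 = (M : ℝ) * (M - 1) * (2 * M - 1) / 6 := by
  induction M with
  | zero => simp
  | succ k ih => rw [sum_Icc_succ_top (by omega), ih]; push_cast; ring

lemma sum_Icc_sub_one_pow_three (M : ℕ) :
    ∑ m ∈ Icc 1 M, ((m : ℝ) - 1) ^ 3 = ((M : ℝ) * (M - 1) / 2) ^ 2 := by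
  induction M with
  | zero => simp
  | succ k ih => rw [sum_Icc_succ_top (by omega), ih]; push_cast; ring

lemma sum_Icc_sub_one_pow_four (M : ℕ) :
    ∑ m ∈ Icc 1 M, ((m : ℝ) - 1) ^ 4 =
      (M : ℝ) * (M - 1) * (2 * M - 1) * (3 * M ^ 2 - 3 * M - 1) / 30 := by
  induction M with
  | zero => simp
  | succ k ih => rw [sum_Icc_succ_top (by omega), ih]; push_cast; ring

lemma coefX_xiPA (c d f_c R : ℝ) (M : ℕ) :
    coefX c M (xiPA d f_c R) = 8 * π ^ 2 / c ^ 2 * (d ^ 2 * f_c / (2 * R ^ 2)) ^ 2 *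
      (M ^ 2 * (M ^ 2 - 1) * (16 * M ^ 2 - 30 * M + 11) / 90) := by
  have h : ∀ m n : ℕ, (2 * (xiPA d f_c R m - xiPA d f_c R n)) ^ 2 =
      4 * (d ^ 2 * f_c / (2 * R ^ 2)) ^ 2 *
        ((((m : ℝ) - 1) ^ 2 - ((n : ℝ) - 1) ^ 2) * (((m : ℝ) - 1) ^ 2 - ((n : ℝ) - 1) ^ 2)) :=
    fun m n => by simp only [xiPA]; ring
  simp only [coefX, h, ← mul_sum]
  rw [sum_sum_sub_mul_sub _ (fun m : ℕ => ((m : ℝ) - 1) ^ 2) (fun m : ℕ => ((m : ℝ) - 1) ^ 2)]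
  simp only [← pow_add, Nat.reduceAdd, sum_Icc_sub_one_pow_two, sum_Icc_sub_one_pow_four,
    Nat.card_Icc, Nat.add_sub_cancel]
  ring

lemma coefY_xiPA (c d f_c θ_D R : ℝ) (M : ℕ) :
    coefY c d f_c θ_D M (xiPA d f_c R) =
      -(8 * π ^ 2 / c ^ 2 * (d ^ 2 * f_c / (2 * R ^ 2)) * (d * f_c * Real.cos θ_D) *
        (M ^ 2 * (M ^ 2 - 1) * (M - 1) / 6)) := by
  have h : ∀ m n : ℕ, 2 * (xiPA d f_c R m - xiPA d f_c R n) * ((m : ℝ) - (n : ℝ)) =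
      -2 * (d ^ 2 * f_c / (2 * R ^ 2)) *
        ((((m : ℝ) - 1) ^ 2 - ((n : ℝ) - 1) ^ 2) * (((m : ℝ) - 1) - ((n : ℝ) - 1))) :=
    fun m n => by simp only [xiPA]; ring
  simp only [coefY, h, ← mul_sum]
  rw [sum_sum_sub_mul_sub _ (fun m : ℕ => ((m : ℝ) - 1) ^ 2) (fun m : ℕ => (m : ℝ) - 1)]
  simp only [← pow_succ, Nat.reduceAdd, sum_Icc_sub_one, sum_Icc_sub_one_pow_two,
    sum_Icc_sub_one_pow_three, Nat.card_Icc, Nat.add_sub_cancel]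
  ring

lemma coefZ_eq (c d f_c θ_D : ℝ) (M : ℕ) :
    coefZ c d f_c θ_D M =
      8 * π ^ 2 / c ^ 2 * (d * f_c * Real.cos θ_D) ^ 2 * (M ^ 2 * (M ^ 2 - 1) / 6) := by
  have h : ∀ m n : ℕ, ((m : ℝ) - (n : ℝ)) ^ 2 =
      (((m : ℝ) - 1) - ((n : ℝ) - 1)) * (((m : ℝ) - 1) - ((n : ℝ) - 1)) :=
    fun m n => by ring
  simp only [coefZ, h]
  rw [sum_sum_sub_mul_sub _ (fun m : ℕ => (m : ℝ) - 1) (fun m : ℕ => (m : ℝ) - 1)]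
  simp only [← pow_two, sum_Icc_sub_one, sum_Icc_sub_one_pow_two, Nat.card_Icc,
    Nat.add_sub_cancel]
  ring

lemma discriminant_xiPA (c d f_c θ_D R : ℝ) (M : ℕ) :
    coefX c M (xiPA d f_c R) * coefZ c d f_c θ_D M - coefY c d f_c θ_D M (xiPA d f_c R) ^ 2 =
      (8 * π ^ 2 / c ^ 2 * (d ^ 2 * f_c / (2 * R ^ 2)) * (d * f_c * Real.cos θ_D)) ^ 2 *
        (M ^ 4 * (M ^ 2 - 1) ^ 2 * (M ^ 2 - 4) / 540) := by
  rw [coefX_xiPA, coefY_xiPA, coefZ_eq]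
  ring

lemma angleBeamwidth_eq {M : ℕ} (hM : 3 ≤ M) {c f_c d R θ_D : ℝ}
    (hc : 0 < c) (hf : 0 < f_c) (hd : 0 < d) (hR : 0 < R) (hθ : 0 < Real.cos θ_D) :
    angleBeamwidth c d f_c θ_D M R =
      c * Real.sqrt (3 * (16 * (M : ℝ) ^ 2 - 30 * (M : ℝ) + 11)) /
        (π * f_c * d * Real.cos θ_D *
          Real.sqrt (((M : ℝ) ^ 2 - 1) * ((M : ℝ) ^ 2 - 4))) := by
  have hM' : (3 : ℝ) ≤ M := by exact_mod_cast hM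
  have h1 : 0 < (M : ℝ) ^ 2 - 1 := by nlinarith
  have h4 : 0 < (M : ℝ) ^ 2 - 4 := by nlinarith
  have hN : 0 ≤ 3 * (16 * (M : ℝ) ^ 2 - 30 * M + 11) := by nlinarith
  have hπ := Real.pi_pos
  have key : (M : ℝ) ^ 2 * coefX c M (xiPA d f_c R) /
      (coefX c M (xiPA d f_c R) * coefZ c d f_c θ_D M -
        coefY c d f_c θ_D M (xiPA d f_c R) ^ 2) =
      (c / (2 * (π * f_c * d * Real.cos θ_D))) ^ 2 *
        (3 * (16 * (M : ℝ) ^ 2 - 30 * M + 11) / (((M : ℝ) ^ 2 - 1) * ((M : ℝ) ^ 2 - 4))) := by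
    rw [discriminant_xiPA, coefX_xiPA]
    field_simp
    ring
  rw [angleBeamwidth, key, Real.sqrt_mul (sq_nonneg _), Real.sqrt_sq (by positivity),
    Real.sqrt_div hN]
  have := Real.sqrt_pos.2 (mul_pos h1 h4)
  field_simp

/-- Corollary 1 and Remark 2 (angular-dimension beamwidth): for a phased array with
`M ≥ 3` antennas, `XZ − Y² > 0`, the angular-dimension beamwidth `2√(M²X/(XZ − Y²))`
equals `c·√(3(16M² − 30M + 11)) / (π·f_c·d·cos θ_D·√((M²−1)(M²−4)))`, and this
beamwidth does not depend on the target distance `R_D`. -/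
theorem phased_array_angle_beamwidth (M : ℕ) (hM : 3 ≤ M) (c f_c d R_D θ_D : ℝ)
    (hc : 0 < c) (hf : 0 < f_c) (hd : 0 < d) (hR : 0 < R_D)
    (hθ : 0 < Real.cos θ_D) :
    0 < coefX c M (xiPA d f_c R_D) * coefZ c d f_c θ_D M -
        coefY c d f_c θ_D M (xiPA d f_c R_D) ^ 2 ∧
    angleBeamwidth c d f_c θ_D M R_D =
      c * Real.sqrt (3 * (16 * (M : ℝ) ^ 2 - 30 * (M : ℝ) + 11)) /
        (π * f_c * d * Real.cos θ_D *
          Real.sqrt (((M : ℝ) ^ 2 - 1) * ((M : ℝ) ^ 2 - 4))) ∧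
    ∀ R₁ R₂ : ℝ, 0 < R₁ → 0 < R₂ →
      angleBeamwidth c d f_c θ_D M R₁ = angleBeamwidth c d f_c θ_D M R₂ := by
  refine ⟨?_, angleBeamwidth_eq hM hc hf hd hR hθ, fun R₁ R₂ h₁ h₂ => ?_⟩
  · have hM' : (3 : ℝ) ≤ M := by exact_mod_cast hM
    have h1 : 0 < (M : ℝ) ^ 2 - 1 := by nlinarith
    have h4 : 0 < (M : ℝ) ^ 2 - 4 := by nlinarith
    rw [discriminant_xiPA]
    positivity
  · rw [angleBeamwidth_eq hM hc hf hd h₁ hθ, angleBeamwidth_eq hM hc hf hd h₂ hθ]
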